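/- Let X and Y be normed spaces, U ⊆ X open and nonempty, and W a set of weight functions f : U → ℝ∪{±∞}. The subspace of functions γ in the weighted function space C^k_W(U,Y) such that for every f ∈ W, ℓ ≤ k and ε > 0 there exists r > 0 with sup_{x∈U, ‖x‖≥r} |f(x)|·‖D^(ℓ)γ(x)‖ < ε, is a closed vector subspace of C^k_W(U,Y). -/

import Mathlib

open Filter Topology Set
open scoped ENNReal NNReal

noncomputable section

variable {X : Type*} [NormedAddCommGroup X] [NormedSpace ℝ X]

/-- The weighted seminorm `sup_{x ∈ U} |f x| · ‖D^(ℓ) γ (x)‖_op`, valued in `ℝ≥0∞`,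
where the weight `f` takes values in the extended real line. -/
def wSemi {Y : Type*} [NormedAddCommGroup Y] [NormedSpace ℝ Y]
    (U : Set X) (f : X → EReal) (ℓ : ℕ) (γ : X → Y) : ℝ≥0∞ :=
  ⨆ x ∈ U, (f x).abs * (‖iteratedFDeriv ℝ ℓ γ x‖₊ : ℝ≥0∞)

/-- Membership in the weighted function space `C^k_W(U, Y)`:  `γ` is `k` times continuously
Fréchet differentiable on `U` and all weighted seminorms up to order `k` are finite. -/
def MemCW {Y : Type*} [NormedAddCommGroup Y] [NormedSpace ℝ Y]
    (U : Set X) (W : Set (X → EReal)) (k : ℕ∞) (γ : X → Y) : Prop :=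
  ContDiffOn ℝ k γ U ∧ ∀ f ∈ W, ∀ ℓ : ℕ, (ℓ : ℕ∞) ≤ k → wSemi U f ℓ γ < ⊤

/-- The subbasic "balls" of the locally convex topology of `C^k_W(U, Y)` (taken inside the
ambient function space). -/
def wBalls (Y : Type*) [NormedAddCommGroup Y] [NormedSpace ℝ Y]
    (U : Set X) (W : Set (X → EReal)) (k : ℕ∞) : Set (Set (X → Y)) :=
  {S | ∃ (γ₀ : X → Y) (f : X → EReal) (ℓ : ℕ) (ε : ℝ≥0∞),
    f ∈ W ∧ (ℓ : ℕ∞) ≤ k ∧ 0 < ε ∧ S = {γ | wSemi U f ℓ (γ - γ₀) < ε}}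

/-- The locally convex topology determined by the weighted seminorms, on the ambient
function space; its restriction to the subtype of `C^k_W` functions is the topology of
`C^k_W(U, Y)`. -/
def wTop (Y : Type*) [NormedAddCommGroup Y] [NormedSpace ℝ Y]
    (U : Set X) (W : Set (X → EReal)) (k : ℕ∞) : TopologicalSpace (X → Y) :=
  .generateFrom (wBalls Y U W k)

/-- The "vanishing at infinity" condition: for every weight, order `ℓ ≤ k` and `ε > 0`
there is `r > 0` such that the weighted seminorm restricted to `{x ∈ U | ‖x‖ ≥ r}` is `< ε`. -/
def VanishCW {Y : Type*} [NormedAddCommGroup Y] [NormedSpace ℝ Y]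
    (U : Set X) (W : Set (X → EReal)) (k : ℕ∞) (γ : X → Y) : Prop :=
  ∀ f ∈ W, ∀ ℓ : ℕ, (ℓ : ℕ∞) ≤ k → ∀ ε : ℝ≥0∞, 0 < ε → ∃ r : ℝ, 0 < r ∧
    (⨆ x ∈ {y ∈ U | r ≤ ‖y‖}, (f x).abs * (‖iteratedFDeriv ℝ ℓ γ x‖₊ : ℝ≥0∞)) < ε

theorem wSemi_mono {Y : Type*} [NormedAddCommGroup Y] [NormedSpace ℝ Y] {S T : Set X}
    (h : S ⊆ T) (f : X → EReal) (ℓ : ℕ) (γ : X → Y) : wSemi S f ℓ γ ≤ wSemi T f ℓ γ :=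
  biSup_mono h

theorem wSemi_zero {Y : Type*} [NormedAddCommGroup Y] [NormedSpace ℝ Y]
    (S : Set X) (f : X → EReal) (ℓ : ℕ) : wSemi S f ℓ (0 : X → Y) = 0 := by
  simp [wSemi]

theorem wSemi_add_le {Y : Type*} [NormedAddCommGroup Y] [NormedSpace ℝ Y] {S : Set X}
    (f : X → EReal) {ℓ : ℕ} {γ η : X → Y}
    (hγ : ∀ x ∈ S, ContDiffAt ℝ ℓ γ x) (hη : ∀ x ∈ S, ContDiffAt ℝ ℓ η x) :
    wSemi S f ℓ (γ + η) ≤ wSemi S f ℓ γ + wSemi S f ℓ η := by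
  refine iSup₂_le fun x hx => ?_
  rw [iteratedFDeriv_add_apply (hγ x hx) (hη x hx)]
  calc (f x).abs * (‖iteratedFDeriv ℝ ℓ γ x + iteratedFDeriv ℝ ℓ η x‖₊ : ℝ≥0∞)
      ≤ (f x).abs * ((‖iteratedFDeriv ℝ ℓ γ x‖₊ : ℝ≥0∞) + ‖iteratedFDeriv ℝ ℓ η x‖₊) := by
        gcongr
        exact_mod_cast nnnorm_add_le _ _
    _ = (f x).abs * (‖iteratedFDeriv ℝ ℓ γ x‖₊ : ℝ≥0∞)
        + (f x).abs * (‖iteratedFDeriv ℝ ℓ η x‖₊ : ℝ≥0∞) := mul_add _ _ _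
    _ ≤ wSemi S f ℓ γ + wSemi S f ℓ η :=
        add_le_add
          (le_iSup₂ (f := fun x (_ : x ∈ S) =>
            (f x).abs * (‖iteratedFDeriv ℝ ℓ γ x‖₊ : ℝ≥0∞)) x hx)
          (le_iSup₂ (f := fun x (_ : x ∈ S) =>
            (f x).abs * (‖iteratedFDeriv ℝ ℓ η x‖₊ : ℝ≥0∞)) x hx)

theorem wSemi_const_smul_le {Y : Type*} [NormedAddCommGroup Y] [NormedSpace ℝ Y] {S : Set X}
    (f : X → EReal) {ℓ : ℕ} (c : ℝ) {γ : X → Y} (hγ : ∀ x ∈ S, ContDiffAt ℝ ℓ γ x) :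
    wSemi S f ℓ (c • γ) ≤ (‖c‖₊ : ℝ≥0∞) * wSemi S f ℓ γ := by
  refine iSup₂_le fun x hx => ?_
  rw [iteratedFDeriv_const_smul_apply (hγ x hx), nnnorm_smul, ENNReal.coe_mul, mul_left_comm]
  gcongr
  exact le_iSup₂ (f := fun x (_ : x ∈ S) =>
    (f x).abs * (‖iteratedFDeriv ℝ ℓ γ x‖₊ : ℝ≥0∞)) x hx

theorem MemCW.contDiffAt {Y : Type*} [NormedAddCommGroup Y] [NormedSpace ℝ Y]
    {U : Set X} {W : Set (X → EReal)} {k : ℕ∞} {γ : X → Y} (h : MemCW U W k γ) (hU : IsOpen U)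
    {ℓ : ℕ} (hℓ : (ℓ : ℕ∞) ≤ k) {x : X} (hx : x ∈ U) : ContDiffAt ℝ ℓ γ x :=
  (h.1.contDiffAt (hU.mem_nhds hx)).of_le (by exact_mod_cast hℓ)

theorem MemCW.add {Y : Type*} [NormedAddCommGroup Y] [NormedSpace ℝ Y]
    {U : Set X} {W : Set (X → EReal)} {k : ℕ∞} {γ η : X → Y} (hU : IsOpen U)
    (hγ : MemCW U W k γ) (hη : MemCW U W k η) : MemCW U W k (γ + η) :=
  ⟨hγ.1.add hη.1, fun f hf ℓ hℓ =>
    (wSemi_add_le f (fun _ hx => hγ.contDiffAt hU hℓ hx)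
      (fun _ hx => hη.contDiffAt hU hℓ hx)).trans_lt
      (ENNReal.add_lt_top.2 ⟨hγ.2 f hf ℓ hℓ, hη.2 f hf ℓ hℓ⟩)⟩

theorem MemCW.const_smul {Y : Type*} [NormedAddCommGroup Y] [NormedSpace ℝ Y]
    {U : Set X} {W : Set (X → EReal)} {k : ℕ∞} {γ : X → Y} (hU : IsOpen U) (c : ℝ)
    (hγ : MemCW U W k γ) : MemCW U W k (c • γ) :=
  ⟨hγ.1.const_smul c, fun f hf ℓ hℓ =>
    (wSemi_const_smul_le f c (fun _ hx => hγ.contDiffAt hU hℓ hx)).trans_lt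
      (ENNReal.mul_lt_top ENNReal.coe_lt_top (hγ.2 f hf ℓ hℓ))⟩

theorem vanishCW_iff {Y : Type*} [NormedAddCommGroup Y] [NormedSpace ℝ Y]
    {U : Set X} {W : Set (X → EReal)} {k : ℕ∞} {γ : X → Y} :
    VanishCW U W k γ ↔ ∀ f ∈ W, ∀ ℓ : ℕ, (ℓ : ℕ∞) ≤ k → ∀ ε : ℝ≥0∞, 0 < ε →
      ∃ r : ℝ, 0 < r ∧ wSemi {y ∈ U | r ≤ ‖y‖} f ℓ γ < ε :=
  Iff.rfl

theorem VanishCW.add {Y : Type*} [NormedAddCommGroup Y] [NormedSpace ℝ Y]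
    {U : Set X} {W : Set (X → EReal)} {k : ℕ∞} {γ η : X → Y} (hU : IsOpen U)
    (hγ : MemCW U W k γ) (hη : MemCW U W k η)
    (vγ : VanishCW U W k γ) (vη : VanishCW U W k η) : VanishCW U W k (γ + η) := by
  rw [vanishCW_iff] at *
  intro f hf ℓ hℓ ε hε
  obtain ⟨r, hr, h⟩ := vγ f hf ℓ hℓ _ (ENNReal.half_pos hε.ne')
  obtain ⟨s, -, h'⟩ := vη f hf ℓ hℓ _ (ENNReal.half_pos hε.ne')
  refine ⟨max r s, lt_max_of_lt_left hr, ?_⟩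
  calc wSemi {y ∈ U | max r s ≤ ‖y‖} f ℓ (γ + η)
      ≤ wSemi {y ∈ U | max r s ≤ ‖y‖} f ℓ γ + wSemi {y ∈ U | max r s ≤ ‖y‖} f ℓ η :=
        wSemi_add_le f (fun _ hx => hγ.contDiffAt hU hℓ hx.1)
          (fun _ hx => hη.contDiffAt hU hℓ hx.1)
    _ ≤ wSemi {y ∈ U | r ≤ ‖y‖} f ℓ γ + wSemi {y ∈ U | s ≤ ‖y‖} f ℓ η :=
        add_le_add
          (wSemi_mono (fun _ => And.imp_right (le_max_left r s).trans) f ℓ γ)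
          (wSemi_mono (fun _ => And.imp_right (le_max_right r s).trans) f ℓ η)
    _ < ε / 2 + ε / 2 := ENNReal.add_lt_add h h'
    _ = ε := ENNReal.add_halves ε

theorem VanishCW.const_smul {Y : Type*} [NormedAddCommGroup Y] [NormedSpace ℝ Y]
    {U : Set X} {W : Set (X → EReal)} {k : ℕ∞} {γ : X → Y} (hU : IsOpen U) (c : ℝ)
    (hγ : MemCW U W k γ) (vγ : VanishCW U W k γ) : VanishCW U W k (c • γ) := by
  rw [vanishCW_iff] at *
  intro f hf ℓ hℓ ε hε
  obtain ⟨r, hr, h⟩ := vγ f hf ℓ hℓ (ε / (‖c‖₊ : ℝ≥0∞))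
    (ENNReal.div_pos hε.ne' ENNReal.coe_ne_top)
  refine ⟨r, hr,
    (wSemi_const_smul_le f c (fun _ hx => hγ.contDiffAt hU hℓ hx.1)).trans_lt ?_⟩
  rw [mul_comm]
  exact ENNReal.mul_lt_of_lt_div h

theorem isOpen_setOf_wSemi_sub_lt {Y : Type*} [NormedAddCommGroup Y] [NormedSpace ℝ Y]
    (U : Set X) {W : Set (X → EReal)} {k : ℕ∞} (γ₀ : X → Y) {f : X → EReal} (hf : f ∈ W)
    {ℓ : ℕ} (hℓ : (ℓ : ℕ∞) ≤ k) {ε : ℝ≥0∞} (hε : 0 < ε) :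
    IsOpen[wTop Y U W k] {γ | wSemi U f ℓ (γ - γ₀) < ε} :=
  .basic _ ⟨γ₀, f, ℓ, ε, hf, hℓ, hε, rfl⟩

/-- A function whose distance to `γ` can be made arbitrarily small in every weighted seminorm
by functions vanishing at infinity vanishes at infinity. -/
theorem VanishCW.of_approx {Y : Type*} [NormedAddCommGroup Y] [NormedSpace ℝ Y]
    {U : Set X} {W : Set (X → EReal)} {k : ℕ∞} {γ : X → Y} (hU : IsOpen U)
    (hγ : MemCW U W k γ)
    (h : ∀ f ∈ W, ∀ ℓ : ℕ, (ℓ : ℕ∞) ≤ k → ∀ ε : ℝ≥0∞, 0 < ε →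
      ∃ η, MemCW U W k η ∧ VanishCW U W k η ∧ wSemi U f ℓ (η - γ) < ε) :
    VanishCW U W k γ := by
  rw [vanishCW_iff]
  intro f hf ℓ hℓ ε hε
  obtain ⟨η, hη, vη, hd⟩ := h f hf ℓ hℓ _ (ENNReal.half_pos hε.ne')
  obtain ⟨r, hr, ht⟩ := vanishCW_iff.1 vη f hf ℓ hℓ _ (ENNReal.half_pos hε.ne')
  have hdiff : ∀ x ∈ U, ContDiffAt ℝ ℓ (η - γ) x := fun x hx =>
    (hη.contDiffAt hU hℓ hx).sub (hγ.contDiffAt hU hℓ hx)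
  refine ⟨r, hr, ?_⟩
  have hsub : {y ∈ U | r ≤ ‖y‖} ⊆ U := fun _ hx => hx.1
  calc wSemi {y ∈ U | r ≤ ‖y‖} f ℓ γ
      = wSemi {y ∈ U | r ≤ ‖y‖} f ℓ (η + (-1 : ℝ) • (η - γ)) := by
        congr 1
        module
    _ ≤ wSemi {y ∈ U | r ≤ ‖y‖} f ℓ η + wSemi {y ∈ U | r ≤ ‖y‖} f ℓ ((-1 : ℝ) • (η - γ)) :=
        wSemi_add_le f (fun _ hx => hη.contDiffAt hU hℓ hx.1) (fun x hx => (hdiff x hx.1).const_smul _)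
    _ ≤ wSemi {y ∈ U | r ≤ ‖y‖} f ℓ η + wSemi {y ∈ U | r ≤ ‖y‖} f ℓ (η - γ) := by
        gcongr
        simpa using wSemi_const_smul_le f (-1) (fun x (hx : x ∈ {y ∈ U | r ≤ ‖y‖}) =>
          hdiff x hx.1)
    _ ≤ wSemi {y ∈ U | r ≤ ‖y‖} f ℓ η + wSemi U f ℓ (η - γ) := by
        gcongr
        exact wSemi_mono hsub f ℓ _
    _ < ε / 2 + ε / 2 := ENNReal.add_lt_add ht hd
    _ = ε := ENNReal.add_halves ε

/-- For normed spaces `X`, `Y`, `U ⊆ X` open and nonempty, and a set `W` of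
weights, the set of functions in `C^k_W(U,Y)` vanishing at infinity is a vector subspace which
is closed in `C^k_W(U,Y)` (equipped with the weighted seminorm topology). -/
theorem stmt0 {Y : Type*} [NormedAddCommGroup Y] [NormedSpace ℝ Y]
    (U : Set X) (hU : IsOpen U) (hne : U.Nonempty)
    (W : Set (X → EReal)) (k : ℕ∞) :
    ((0 : X → Y) ∈ {γ | MemCW U W k γ ∧ VanishCW U W k γ}) ∧
    (∀ γ η : X → Y, γ ∈ {γ | MemCW U W k γ ∧ VanishCW U W k γ} →
      η ∈ {γ | MemCW U W k γ ∧ VanishCW U W k γ} →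
      γ + η ∈ {γ | MemCW U W k γ ∧ VanishCW U W k γ}) ∧
    (∀ (c : ℝ) (γ : X → Y), γ ∈ {γ | MemCW U W k γ ∧ VanishCW U W k γ} →
      c • γ ∈ {γ | MemCW U W k γ ∧ VanishCW U W k γ}) ∧
    (letI : TopologicalSpace (X → Y) := wTop Y U W k
     IsClosed {γ : {γ : X → Y // MemCW U W k γ} | VanishCW U W k γ.1}) := by
  refine ⟨⟨⟨contDiffOn_const, fun f _ ℓ _ => by simp [wSemi_zero]⟩, ?_⟩, ?_, ?_, ?_⟩
  · rw [vanishCW_iff]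
    exact fun f _ ℓ _ ε hε => ⟨1, one_pos, by rwa [wSemi_zero]⟩
  · exact fun γ η hγ hη => ⟨hγ.1.add hU hη.1, hγ.2.add hU hγ.1 hη.1 hη.2⟩
  · exact fun c γ hγ => ⟨hγ.1.const_smul hU c, hγ.2.const_smul hU c hγ.1⟩
  · let : TopologicalSpace (X → Y) := wTop Y U W k
    refine isClosed_of_closure_subset fun γ hγ => VanishCW.of_approx hU γ.2 ?_
    intro f hf ℓ hℓ ε hε
    have hopen : IsOpen {η : {γ : X → Y // MemCW U W k γ} | wSemi U f ℓ (η.1 - γ.1) < ε} :=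
      (isOpen_setOf_wSemi_sub_lt U γ.1 hf hℓ hε).preimage continuous_subtype_val
    obtain ⟨η, hd, vη⟩ := mem_closure_iff.1 hγ _ hopen (by simpa [wSemi_zero] using hε)
    exact ⟨η.1, η.2, vη, hd⟩
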